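/- Let I be a combinatorial abelian ideal in Φ⁺, let S ⊆ I be a set of pairwise orthogonal roots, set σ_S = ∏_{b∈S} s_b, and let α ∈ Δ be a simple root satisfying the following descent condition: either Σ_{b∈S} ⟨α, b∨⟩ < 0, or (Σ_{b∈S} ⟨α, b∨⟩ = 0 and σ_S(α) ∈ Φ⁻). Then s_α(S) = {s_α(b) : b ∈ S} ⊆ I; moreover s_α(S) = S if and only if σ_S(α) = −α. -/

import Mathlib

open scoped RealInnerProductSpace

variable {V : Type*} [NormedAddCommGroup V] [InnerProductSpace ℝ V] [FiniteDimensional ℝ V]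

/-- The Cartan integer `⟨a, b∨⟩ = 2⟪a,b⟫/⟪b,b⟫`, i.e. the pairing of `a` with the coroot
of `b`, in a Euclidean realization of the root system. -/
noncomputable def cartan (a b : V) : ℝ := 2 * ⟪a, b⟫ / ⟪b, b⟫

/-- A finite reduced crystallographic root system `Φ` in a Euclidean space `V`,
together with a base `Δ` (the set `simples`); the corresponding positive system `Φ⁺`
consists of the roots that are nonnegative integer combinations of simple roots. -/
structure RootSystemWithBase (V : Type*) [NormedAddCommGroup V] [InnerProductSpace ℝ V] :
    Type _ where
  roots : Set V
  finite : roots.Finite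
  ne_zero : ∀ a ∈ roots, a ≠ (0 : V)
  neg_mem : ∀ a ∈ roots, -a ∈ roots
  reduced : ∀ a ∈ roots, ∀ t : ℝ, t • a ∈ roots → t = 1 ∨ t = -1
  crystal : ∀ a ∈ roots, ∀ b ∈ roots, ∃ n : ℤ, cartan a b = (n : ℝ)
  reflect_mem : ∀ a ∈ roots, ∀ b ∈ roots, a - cartan a b • b ∈ roots
  simples : Set V
  simples_sub : simples ⊆ roots
  indep : LinearIndependent ℝ (fun a : simples => (a : V))
  decomp : ∀ a ∈ roots,
    (∃ c : V →₀ ℕ, ↑c.support ⊆ simples ∧ a = c.sum fun b n => (n : ℝ) • b) ∨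
    (∃ c : V →₀ ℕ, ↑c.support ⊆ simples ∧ -a = c.sum fun b n => (n : ℝ) • b)

namespace RootSystemWithBase

/-- `v` is a nonnegative integer combination of simple roots. -/
def IsNN (R : RootSystemWithBase V) (v : V) : Prop :=
  ∃ c : V →₀ ℕ, ↑c.support ⊆ R.simples ∧ v = c.sum fun b n => (n : ℝ) • b

/-- The set `Φ⁺` of positive roots. -/
def pos (R : RootSystemWithBase V) : Set V :=
  {a ∈ R.roots | R.IsNN a}

/-- A combinatorial abelian ideal in `Φ⁺`: a subset `I ⊆ Φ⁺` such that (i) if `a ∈ I`,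
`b ∈ Φ⁺` and `b - a` is a nonnegative integer combination of simple roots then `b ∈ I`,
and (ii) `a + b ∉ Φ` for all `a, b ∈ I`. -/
def IsAbelianIdeal (R : RootSystemWithBase V) (I : Set V) : Prop :=
  I ⊆ R.pos ∧
  (∀ a ∈ I, ∀ b ∈ R.pos, R.IsNN (b - a) → b ∈ I) ∧
  (∀ a ∈ I, ∀ b ∈ I, a + b ∉ R.roots)

end RootSystemWithBase

/-- The reflection `s_b` associated to a root `b`: `x ↦ x - ⟨x, b∨⟩ b`. -/
noncomputable def reflV (b : V) : V → V := fun x => x - cartan x b • b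

/-- The product `σ_S = ∏_{b ∈ S} s_b` of the reflections associated to the elements of a
finite set `S` of roots (for pairwise orthogonal `S` these reflections commute, so the
product does not depend on the chosen enumeration of `S`). -/
noncomputable def sigmaS (S : Finset V) : V → V :=
  S.toList.foldr (fun b f => reflV b ∘ f) id

section CartanPairing

variable {W : Type*} [NormedAddCommGroup W] [InnerProductSpace ℝ W]

lemma cartan_add_left (a b c : W) : cartan (a + b) c = cartan a c + cartan b c := by
  simp only [cartan, inner_add_left]; ring

lemma cartan_sub_left (a b c : W) : cartan (a - b) c = cartan a c - cartan b c := by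
  simp only [cartan, inner_sub_left]; ring

lemma cartan_smul_left (t : ℝ) (a b : W) : cartan (t • a) b = t * cartan a b := by
  simp only [cartan, real_inner_smul_left]; ring

lemma cartan_self {a : W} (ha : a ≠ 0) : cartan a a = 2 := by
  have : ⟪a, a⟫ ≠ 0 := inner_self_ne_zero.mpr ha
  simp only [cartan]; field_simp

lemma cartan_mul_inner (a : W) {b : W} (hb : b ≠ 0) : cartan a b * ⟪b, b⟫ = 2 * ⟪a, b⟫ := by
  have : ⟪b, b⟫ ≠ 0 := inner_self_ne_zero.mpr hb
  simp only [cartan]; field_simp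

lemma cartan_neg_iff_inner_neg (a : W) {b : W} (hb : b ≠ 0) : cartan a b < 0 ↔ ⟪a, b⟫ < 0 := by
  have h := cartan_mul_inner a hb
  have hp : 0 < ⟪b, b⟫ := real_inner_self_pos.mpr hb
  constructor <;> intro h' <;> nlinarith

lemma cartan_neg_comm {a b : W} (ha : a ≠ 0) (hb : b ≠ 0) : cartan a b < 0 ↔ cartan b a < 0 := by
  rw [cartan_neg_iff_inner_neg a hb, cartan_neg_iff_inner_neg b ha, real_inner_comm]

lemma cartan_pos_iff_inner_pos (a : W) {b : W} (hb : b ≠ 0) : 0 < cartan a b ↔ 0 < ⟪a, b⟫ := by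
  have h := cartan_mul_inner a hb
  have hp : 0 < ⟪b, b⟫ := real_inner_self_pos.mpr hb
  constructor <;> intro h' <;> nlinarith

lemma cartan_pos_comm {a b : W} (ha : a ≠ 0) (hb : b ≠ 0) : 0 < cartan a b ↔ 0 < cartan b a := by
  rw [cartan_pos_iff_inner_pos a hb, cartan_pos_iff_inner_pos b ha, real_inner_comm]

lemma cartan_eq_zero_comm {a b : W} (ha : a ≠ 0) (hb : b ≠ 0) :
    cartan a b = 0 ↔ cartan b a = 0 := by
  have h1 := cartan_neg_comm ha hb
  have h2 := cartan_pos_comm ha hb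
  constructor <;> intro h <;> apply le_antisymm <;> by_contra! h' <;>
    simp_all

lemma reflV_reflV {a : W} (ha : a ≠ 0) (x : W) : reflV a (reflV a x) = x := by
  simp only [reflV, cartan_sub_left, cartan_smul_left, cartan_self ha]
  module

lemma cartan_reflV {a : W} (ha : a ≠ 0) (b : W) : cartan a (reflV a b) = -cartan a b := by
  have h := cartan_mul_inner b ha
  have h1 : ⟪a, reflV a b⟫ = -⟪a, b⟫ := by
    simp only [reflV, inner_sub_right, real_inner_smul_right, h, real_inner_comm]; ring
  have h2 : ⟪reflV a b, reflV a b⟫ = ⟪b, b⟫ := by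
    simp only [reflV, inner_sub_right, inner_sub_left, real_inner_smul_right,
      real_inner_smul_left, ← real_inner_comm a b]
    linear_combination cartan b a * h
  rw [cartan, h1, h2, cartan]; ring

lemma foldr_reflV_apply (l : List W) (hl : l.Pairwise fun a b => cartan b a = 0) (x : W) :
    l.foldr (fun b f => reflV b ∘ f) id x = x - (l.map fun b => cartan x b • b).sum := by
  induction l with
  | nil => simp
  | cons b l ih =>
    rw [List.pairwise_cons] at hl
    have hzero : ∀ m : List W, (∀ a ∈ m, cartan a b = 0) →
        cartan (m.map fun a => cartan x a • a).sum b = 0 := by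
      intro m hm
      induction m with
      | nil => simp [cartan]
      | cons a m ihm =>
        simp only [List.map_cons, List.sum_cons, cartan_add_left, cartan_smul_left]
        rw [hm a (by simp), ihm fun c hc => hm c (by simp [hc])]
        simp
    simp only [List.foldr_cons, Function.comp_apply, ih hl.2, List.map_cons, List.sum_cons]
    rw [reflV, cartan_sub_left, hzero l hl.1]
    module

lemma sigmaS_apply (S : Finset W) (horth : ∀ a ∈ S, ∀ b ∈ S, a ≠ b → cartan a b = 0) (x : W) :
    sigmaS S x = x - ∑ b ∈ S, cartan x b • b := by
  rw [sigmaS, foldr_reflV_apply, Finset.sum_map_toList]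
  refine S.nodup_toList.imp_of_mem fun ha hb hab => ?_
  exact horth _ (Finset.mem_toList.mp hb) _ (Finset.mem_toList.mp ha) hab.symm

end CartanPairing

namespace RootSystemWithBase

section

variable {W : Type*} [NormedAddCommGroup W] [InnerProductSpace ℝ W]
  (R : RootSystemWithBase W)

lemma exists_linearMap (g : W → ℝ) : ∃ f : W →ₗ[ℝ] ℝ, ∀ b ∈ R.simples, f b = g b := by
  have hs : LinearIndepOn ℝ id R.simples := R.indep
  refine ⟨(Module.Basis.extend hs).constr ℝ fun b => g b, fun b hb => ?_⟩
  have h := (Module.Basis.extend hs).constr_basis ℝ (fun b => g b) ⟨b, hs.subset_extend _ hb⟩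
  simpa using h

variable {R}

lemma IsNN.add {v w : W} (hv : R.IsNN v) (hw : R.IsNN w) : R.IsNN (v + w) := by
  classical
  obtain ⟨c, hc, rfl⟩ := hv
  obtain ⟨d, hd, rfl⟩ := hw
  refine ⟨c + d, fun x hx => ?_, ?_⟩
  · rcases Finset.mem_union.mp (Finsupp.support_add hx) with h | h
    exacts [hc h, hd h]
  · rw [Finsupp.sum_add_index'] <;> intros <;> simp [add_smul]

lemma isNN_nsmul {a : W} (ha : a ∈ R.simples) (n : ℕ) : R.IsNN ((n : ℝ) • a) := by
  classical
  refine ⟨Finsupp.single a n, fun x hx => ?_, by simp⟩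
  have := Finsupp.support_single_subset hx
  simp_all

lemma isNN_simple {a : W} (ha : a ∈ R.simples) : R.IsNN a := by
  simpa using isNN_nsmul ha 1

lemma isNN_zero : R.IsNN (0 : W) := ⟨0, by simp, by simp⟩

lemma IsNN.map_nonneg {v : W} (hv : R.IsNN v) {f : W →ₗ[ℝ] ℝ}
    (hf : ∀ b ∈ R.simples, 0 ≤ f b) : 0 ≤ f v := by
  obtain ⟨c, hc, rfl⟩ := hv
  rw [Finsupp.sum, map_sum]
  refine Finset.sum_nonneg fun b hb => ?_
  simpa using mul_nonneg (Nat.cast_nonneg (c b)) (hf b (hc hb))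

lemma IsNN.eq_zero {v : W} (hv : R.IsNN v) (hv' : R.IsNN (-v)) : v = 0 := by
  obtain ⟨f, hf⟩ := R.exists_linearMap fun _ => 1
  have h0 : f v = 0 := by
    have h1 := hv.map_nonneg (f := f) fun b hb => by simp [hf b hb]
    have h2 := hv'.map_nonneg (f := f) fun b hb => by simp [hf b hb]
    rw [map_neg] at h2
    linarith
  obtain ⟨c, hc, rfl⟩ := hv
  rw [Finsupp.sum, map_sum, Finset.sum_eq_zero_iff_of_nonneg] at h0
  · refine Finset.sum_eq_zero fun b hb => ?_
    have := h0 b hb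
    simp_all [hf b (hc hb)]
  · intro b hb
    simp [hf b (hc hb)]

lemma neg_notMem_pos {a : W} (ha : a ∈ R.pos) : -a ∉ R.pos := fun h =>
  R.ne_zero a ha.1 (ha.2.eq_zero h.2)

lemma add_ne_zero_of_mem_pos {a b : W} (ha : a ∈ R.pos) (hb : b ∈ R.pos) : a + b ≠ 0 := fun h =>
  neg_notMem_pos ha (by rwa [neg_eq_of_add_eq_zero_right h])

lemma simple_mem_pos {a : W} (ha : a ∈ R.simples) : a ∈ R.pos :=
  ⟨R.simples_sub ha, isNN_simple ha⟩

lemma reflV_mem_pos {α : W} (hα : α ∈ R.simples) {a : W} (ha : a ∈ R.pos) (hne : a ≠ α) :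
    reflV α a ∈ R.pos := by
  classical
  have hroot : reflV α a ∈ R.roots := R.reflect_mem a ha.1 α (R.simples_sub hα)
  obtain ⟨f, hf⟩ := R.exists_linearMap fun b => if b = α then 0 else 1
  have hf0 : ∀ b ∈ R.simples, 0 ≤ f b := fun b hb => by
    rw [hf b hb]; split_ifs <;> norm_num
  have hfα : f α = 0 := by simp [hf α hα]
  refine ⟨hroot, (R.decomp _ hroot).resolve_right fun hneg => ?_⟩
  have h1 := IsNN.map_nonneg (R := R) hneg hf0
  have h2 := ha.2.map_nonneg hf0
  have h3 : f a = 0 := by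
    simp only [reflV, map_neg, map_sub, map_smul, hfα, smul_zero, sub_zero] at h1
    linarith
  obtain ⟨c, hc, hac⟩ := ha.2
  have h4 := h3
  rw [hac, Finsupp.sum, map_sum, Finset.sum_eq_zero_iff_of_nonneg] at h4
  · have h5 : ∀ b ∈ c.support, b = α := fun b hb => by
      have := h4 b hb
      simp_all [hf b (hc hb)]
    have h6 : a = (c α : ℝ) • α := by
      rw [hac]
      refine Finset.sum_eq_single α (fun b hb h => absurd (h5 b hb) h) fun h => ?_
      simp [Finsupp.notMem_support_iff.mp h]
    rcases R.reduced α (R.simples_sub hα) (c α) (h6 ▸ ha.1) with h | h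
    · exact hne (by rw [h6, h, one_smul])
    · have : (0 : ℝ) ≤ c α := Nat.cast_nonneg _
      linarith
  · intro b hb
    simpa using mul_nonneg (Nat.cast_nonneg (c b)) (hf0 b (hc hb))

lemma eq_zero_of_cartan_lt_one {a b : W} (ha : a ∈ R.roots) (hb : b ∈ R.roots)
    (h0 : 0 ≤ cartan a b) (h1 : cartan a b < 1) : cartan a b = 0 := by
  obtain ⟨n, hn⟩ := R.crystal a ha b hb
  rw [hn] at h0 h1 ⊢
  have : 0 ≤ n := by exact_mod_cast h0
  have : n < 1 := by exact_mod_cast h1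
  have : n = 0 := by omega
  simp [this]

lemma add_mem_roots {a b : W} (ha : a ∈ R.roots) (hb : b ∈ R.roots) (h : cartan a b < 0)
    (hne : a + b ≠ 0) : a + b ∈ R.roots := by
  have ha0 := R.ne_zero a ha
  have hb0 := R.ne_zero b hb
  have h' : cartan b a < 0 := (cartan_neg_comm ha0 hb0).mp h
  obtain ⟨m, hm⟩ := R.crystal a ha b hb
  obtain ⟨n, hn⟩ := R.crystal b hb a ha
  have hm0 : m < 0 := by rw [hm] at h; exact_mod_cast h
  have hn0 : n < 0 := by rw [hn] at h'; exact_mod_cast h'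
  by_cases hm1 : m = -1
  · have := R.reflect_mem a ha b hb
    rw [hm, hm1] at this
    simpa using this
  by_cases hn1 : n = -1
  · have := R.reflect_mem b hb a ha
    rw [hn, hn1] at this
    simpa [add_comm] using this
  exfalso
  have hm2 : (m : ℝ) ≤ -2 := by exact_mod_cast (by omega : m ≤ -2)
  have hn2 : (n : ℝ) ≤ -2 := by exact_mod_cast (by omega : n ≤ -2)
  have e1 := cartan_mul_inner a hb0
  have e2 := cartan_mul_inner b ha0
  rw [hm] at e1
  rw [hn, real_inner_comm a b] at e2
  have pa : 0 < ⟪a, a⟫ := real_inner_self_pos.mpr ha0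
  have pb : 0 < ⟪b, b⟫ := real_inner_self_pos.mpr hb0
  have ps : 0 < ⟪a + b, a + b⟫ := real_inner_self_pos.mpr hne
  rw [real_inner_add_add_self] at ps
  nlinarith

namespace IsAbelianIdeal

variable {I : Set W} {α : W}

lemma add_simple_mem (hI : R.IsAbelianIdeal I) (hα : α ∈ R.simples) {b : W}
    (hb : b ∈ I) (h : cartan α b < 0) : α + b ∈ I := by
  have hbp := hI.1 hb
  have hr : α + b ∈ R.roots := add_mem_roots (R.simples_sub hα) hbp.1 h
    (add_ne_zero_of_mem_pos (simple_mem_pos hα) hbp)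
  refine hI.2.1 b hb _ ⟨hr, (isNN_simple hα).add hbp.2⟩ ?_
  simpa using isNN_simple hα

lemma reflV_mem_of_nonpos (hI : R.IsAbelianIdeal I) (hα : α ∈ R.simples) {b : W}
    (hb : b ∈ I) (h : cartan α b ≤ 0) : reflV α b ∈ I := by
  have hbp := hI.1 hb
  have hαr := R.simples_sub hα
  have hr : reflV α b ∈ R.roots := R.reflect_mem b hbp.1 α hαr
  have h' : cartan b α ≤ 0 := by
    rw [← not_lt] at h ⊢
    rwa [cartan_pos_comm (R.ne_zero b hbp.1) (R.ne_zero α hαr)]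
  obtain ⟨n, hn⟩ := R.crystal b hbp.1 α hαr
  have hn0 : n ≤ 0 := by rw [hn] at h'; exact_mod_cast h'
  obtain ⟨k, rfl⟩ : ∃ k : ℕ, n = -k := ⟨n.natAbs, by omega⟩
  have he : reflV α b = b + (k : ℝ) • α := by
    rw [reflV, hn]; push_cast; module
  refine hI.2.1 b hb _ ⟨hr, ?_⟩ ?_
  · rw [he]; exact hbp.2.add (isNN_nsmul hα k)
  · rw [he, add_sub_cancel_left]; exact isNN_nsmul hα k

lemma cartan_eq_neg_one (hI : R.IsAbelianIdeal I) (hα : α ∈ R.simples) {b : W}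
    (hb : b ∈ I) (h : cartan α b < 0) : cartan α b = -1 := by
  have hbp := hI.1 hb
  have hb0 := R.ne_zero b hbp.1
  have hm := hI.add_simple_mem hα hb h
  have hnot := hI.2.2 _ hm _ hb
  obtain ⟨n, hn⟩ := R.crystal α (R.simples_sub hα) b hbp.1
  have hn0 : n < 0 := by rw [hn] at h; exact_mod_cast h
  by_contra hne
  have hn1 : n ≠ -1 := by rintro rfl; exact hne (by simpa using hn)
  apply hnot
  by_cases hn2 : n = -2
  · have := R.reflect_mem α (R.simples_sub hα) b hbp.1
    rw [hn, hn2] at this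
    convert! this using 1
    push_cast; module
  · refine add_mem_roots (hI.1 hm).1 hbp.1 ?_ (add_ne_zero_of_mem_pos (hI.1 hm) hbp)
    have : (n : ℝ) ≤ -3 := by exact_mod_cast (by omega : n ≤ -3)
    rw [cartan_add_left, cartan_self hb0, hn]
    linarith

lemma cartan_nonneg_of_neg (hI : R.IsAbelianIdeal I) (hα : α ∈ R.simples) {b c : W}
    (hb : b ∈ I) (hc : c ∈ I) (hbc : cartan b c = 0)
    (h : cartan α b < 0) : 0 ≤ cartan α c := by
  by_contra! h'
  have hm := hI.add_simple_mem hα hb h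
  refine hI.2.2 _ hm _ hc (add_mem_roots (hI.1 hm).1 (hI.1 hc).1 ?_
    (add_ne_zero_of_mem_pos (hI.1 hm) (hI.1 hc)))
  rwa [cartan_add_left, hbc, add_zero]

/-- If two elements `b` and `c` of an abelian ideal satisfy `b - c = 2α` and `⟨α, b∨⟩ = 1 = -⟨α, c∨⟩`,
then `⟨b, α∨⟩ = 2`, so that the reflection in `α` exchanges `b` and `c`. -/
lemma cartan_eq_two (hI : R.IsAbelianIdeal I) (hα : α ∈ R.simples) {b c : W}
    (hb : b ∈ I) (hc : c ∈ I) (hb1 : cartan α b = 1)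
    (hc1 : cartan α c = -1) (h : b - c = (2 : ℝ) • α) : cartan b α = 2 := by
  have hαr := R.simples_sub hα
  have hα0 := R.ne_zero α hαr
  have hbp := hI.1 hb
  have hcp := hI.1 hc
  have hb0 := R.ne_zero b hbp.1
  have hc0 := R.ne_zero c hcp.1
  have hd : 0 < cartan b α := (cartan_pos_comm hα0 hb0).mp (by rw [hb1]; norm_num)
  have he : cartan c α < 0 := (cartan_neg_comm hα0 hc0).mp (by rw [hc1]; norm_num)
  have hde : cartan b α - cartan c α = 4 := by
    rw [← cartan_sub_left, h, cartan_smul_left, cartan_self hα0]; norm_num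
  obtain ⟨d, hd'⟩ := R.crystal b hbp.1 α hαr
  obtain ⟨e, he'⟩ := R.crystal c hcp.1 α hαr
  rw [hd'] at hd hde ⊢
  rw [he'] at he hde
  norm_cast at hd he hde ⊢
  have hb_eq : b = c + (2 : ℝ) • α := by rw [← h]; abel
  have hcα := hI.add_simple_mem hα hc (by rw [hc1]; norm_num)
  by_contra hd2
  obtain hd1 | hd3 : d = 1 ∨ d = 3 := by omega
  · have hr : b + α ∈ R.roots := by
      have := R.reflect_mem c hcp.1 α hαr
      rw [he', show e = -3 by omega] at this
      convert! this using 1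
      rw [hb_eq]; push_cast; module
    have := R.neg_mem _ (R.reflect_mem _ hr b hbp.1)
    rw [cartan_add_left, cartan_self hb0, hb1] at this
    refine hI.2.2 _ hcα _ hb ?_
    convert! this using 1
    rw [hb_eq]; module
  · have hr : c - α ∈ R.roots := by
      have := R.reflect_mem b hbp.1 α hαr
      rw [hd', hd3] at this
      convert! this using 1
      rw [hb_eq]; push_cast; module
    have := R.neg_mem _ (R.reflect_mem _ hr c hcp.1)
    rw [cartan_sub_left, cartan_self hc0, hc1] at this
    refine hI.2.2 _ hcα _ hc ?_
    convert! this using 1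
    module

lemma reflV_mem_of_sub_mem_pos (hI : R.IsAbelianIdeal I) (hα : α ∈ R.simples) {b c : W}
    (hb : b ∈ I) (hc : c ∈ I) (hb1 : cartan α b = 1)
    (hc1 : cartan α c = -1) (hγ : b - c - α ∈ R.pos) : reflV α b ∈ I := by
  have hαr := R.simples_sub hα
  have hα0 := R.ne_zero α hαr
  have hbp := hI.1 hb
  have hcp := hI.1 hc
  have hbα : b ≠ α := by
    rintro rfl
    rw [cartan_self hα0] at hb1
    norm_num at hb1
  have hsb := reflV_mem_pos hα hbp hbα
  refine hI.2.1 c hc _ hsb ?_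
  by_cases h : b - c - α = α
  · have h' : b - c = (2 : ℝ) • α := by rw [two_smul]; exact sub_eq_iff_eq_add.mp h
    have hd := hI.cartan_eq_two hα hb hc hb1 hc1 h'
    rw [reflV, hd, ← h']
    simpa using isNN_zero (R := R)
  · have hs := reflV_mem_pos hα hγ h
    have he : cartan c α < 0 :=
      (cartan_neg_comm hα0 (R.ne_zero c hcp.1)).mp (by rw [hc1]; norm_num)
    obtain ⟨e, he'⟩ := R.crystal c hcp.1 α hαr
    rw [he'] at he
    norm_cast at he
    obtain ⟨k, rfl⟩ : ∃ k : ℕ, e = -(k + 1) := ⟨(-e - 1).toNat, by omega⟩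
    convert! hs.2.add (isNN_nsmul hα k) using 1
    simp only [reflV, cartan_sub_left, he', cartan_self hα0]
    push_cast; module

end IsAbelianIdeal

end

end RootSystemWithBase

open RootSystemWithBase

/-- Let `S` be a pairwise orthogonal subset of a combinatorial abelian ideal `I` and let
`α ∈ Δ` satisfy the descent condition: either `Σ_{b∈S} ⟨α, b∨⟩ < 0`, or
(`Σ_{b∈S} ⟨α, b∨⟩ = 0` and `σ_S(α) ∈ Φ⁻`). Then `s_α(S) ⊆ I`, and `s_α(S) = S` if and
only if `σ_S(α) = -α`. -/
theorem stmt_6 [DecidableEq V] (R : RootSystemWithBase V) (I : Set V)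
    (hI : R.IsAbelianIdeal I) (S : Finset V) (hSI : ↑S ⊆ I)
    (horth : ∀ a ∈ S, ∀ b ∈ S, a ≠ b → cartan a b = 0)
    (α : V) (hα : α ∈ R.simples)
    (hdesc : (∑ b ∈ S, cartan α b < 0) ∨
      (∑ b ∈ S, cartan α b = 0 ∧ -(sigmaS S α) ∈ R.pos)) :
    ↑(S.image (reflV α)) ⊆ I ∧ (S.image (reflV α) = S ↔ sigmaS S α = -α) := by
  have hαr := R.simples_sub hα
  have hα0 := R.ne_zero α hαr
  have hr : ∀ b ∈ S, b ∈ R.roots := fun b hb => (hI.1 (hSI hb)).1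
  have hσ := sigmaS_apply S horth α
  have hrefl0 : ∀ b ∈ S, cartan α b = 0 → reflV α b = b := fun b hb h => by
    rw [reflV, (cartan_eq_zero_comm hα0 (R.ne_zero b (hr b hb))).mp h, zero_smul, sub_zero]
  by_cases hneg : ∃ c ∈ S, cartan α c < 0
  · obtain ⟨c, hc, hc0⟩ := hneg
    have hc1 := hI.cartan_eq_neg_one hα (hSI hc) hc0
    have hnn : ∀ b ∈ S.erase c, 0 ≤ cartan α b := fun b hb => by
      obtain ⟨hbc, hb⟩ := Finset.mem_erase.mp hb
      exact hI.cartan_nonneg_of_neg hα (hSI hc) (hSI hb) (horth c hc b hb hbc.symm) hc0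
    have hsum := Finset.add_sum_erase S (fun b => cartan α b) hc
    have hvec := Finset.add_sum_erase S (fun b => cartan α b • b) hc
    simp only [hc1] at hsum hvec
    rcases hdesc with hlt | ⟨heq, hpos⟩
    · have hzero : ∀ b ∈ S.erase c, cartan α b = 0 := fun b hb => by
        refine eq_zero_of_cartan_lt_one hαr (hr b (Finset.mem_of_mem_erase hb)) (hnn b hb) ?_
        have := Finset.single_le_sum hnn hb
        linarith
      have hnp : ∀ b ∈ S, cartan α b ≤ 0 := fun b hb => by
        by_cases h : b = c
        · rw [h]; exact hc0.le
        · exact (hzero b (Finset.mem_erase.mpr ⟨h, hb⟩)).le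
      refine ⟨?_, iff_of_false (fun h => ?_) fun h => ?_⟩
      · intro x hx
        obtain ⟨b, hb, rfl⟩ := Finset.mem_image.mp hx
        exact hI.reflV_mem_of_nonpos hα (hSI hb) (hnp b hb)
      · have := hnp _ (h ▸ Finset.mem_image_of_mem (reflV α) hc)
        rw [cartan_reflV hα0, hc1] at this
        norm_num at this
      · rw [hσ, ← hvec, Finset.sum_eq_zero fun b hb => by rw [hzero b hb, zero_smul]] at h
        refine add_ne_zero_of_mem_pos (simple_mem_pos hα)
          (hI.1 (hI.add_simple_mem hα (hSI hc) hc0)) ?_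
        rw [← sub_eq_zero] at h
        rw [← h]
        module
    · obtain ⟨b, hb, hb0⟩ : ∃ b ∈ S.erase c, cartan α b ≠ 0 := by
        by_contra! h
        rw [Finset.sum_eq_zero h] at hsum
        linarith
      have hb1 : cartan α b = 1 := by
        refine le_antisymm ?_ ?_
        · have := Finset.single_le_sum hnn hb
          linarith
        · by_contra! h
          exact hb0 (eq_zero_of_cartan_lt_one hαr (hr b (Finset.mem_of_mem_erase hb)) (hnn b hb) h)
      have hsum' := Finset.add_sum_erase (S.erase c) (fun b => cartan α b) hb
      have hvec' := Finset.add_sum_erase (S.erase c) (fun b => cartan α b • b) hb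
      simp only [hb1] at hsum' hvec'
      have hzero : ∀ x ∈ (S.erase c).erase b, cartan α x = 0 := by
        rw [← Finset.sum_eq_zero_iff_of_nonneg fun x hx => hnn x (Finset.mem_of_mem_erase hx)]
        linarith
      have hzero' : ∀ x ∈ S, x ≠ b → x ≠ c → cartan α x = 0 := fun x hx h1 h2 =>
        hzero x (by simp [hx, h1, h2])
      rw [Finset.sum_eq_zero fun x hx => by rw [hzero x hx, zero_smul]] at hvec'
      replace hb := Finset.mem_of_mem_erase hb
      have hσ' : sigmaS S α = α - b + c := by
        rw [hσ, ← hvec, ← hvec']; module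
      have hγ : b - c - α ∈ R.pos := by
        convert! hpos using 1
        rw [hσ']; abel
      refine ⟨?_, fun h => ?_, fun h => ?_⟩
      · intro x hx
        obtain ⟨y, hy, rfl⟩ := Finset.mem_image.mp hx
        by_cases hyb : y = b
        · rw [hyb]; exact hI.reflV_mem_of_sub_mem_pos hα (hSI hb) (hSI hc) hb1 hc1 hγ
        · refine hI.reflV_mem_of_nonpos hα (hSI hy) ?_
          by_cases hyc : y = c
          · rw [hyc]; exact hc0.le
          · exact (hzero' y hy hyb hyc).le
      · have hmem : reflV α b ∈ S := h ▸ Finset.mem_image_of_mem (reflV α) hb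
        have hcb := cartan_reflV hα0 b
        rw [hb1] at hcb
        have hbc : reflV α b = c := by
          by_contra h2
          by_cases h1 : reflV α b = b
          · rw [h1, hb1] at hcb; norm_num at hcb
          · rw [hzero' _ hmem h1 h2] at hcb; norm_num at hcb
        have hd : 0 < cartan b α :=
          (cartan_pos_comm hα0 (R.ne_zero b (hr b hb))).mp (by rw [hb1]; norm_num)
        have he : b - c - α = (cartan b α - 1) • α := by
          rw [← hbc, reflV]; module
        have hd2 : cartan b α - 1 = 1 :=
          (R.reduced α hαr _ (he ▸ hγ.1)).resolve_right fun h' => by linarith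
        rw [hd2, one_smul] at he
        rw [hσ', ← neg_inj, neg_neg]
        refine Eq.trans ?_ he
        abel
      · have h2 : b - c = (2 : ℝ) • α := by
          rw [hσ', ← sub_eq_zero] at h
          rw [← sub_eq_zero, ← neg_eq_zero, ← h]
          module
        have hd := hI.cartan_eq_two hα (hSI hb) (hSI hc) hb1 hc1 h2
        have hsb : reflV α b = c := by rw [reflV, hd, ← h2]; abel
        have hsc : reflV α c = b := by rw [← hsb, reflV_reflV hα0]
        have hinj : Function.Injective (reflV α) :=
          Function.LeftInverse.injective (reflV_reflV hα0)
        refine Finset.eq_of_subset_of_card_le (fun x hx => ?_)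
          (Finset.card_image_of_injective S hinj).ge
        obtain ⟨y, hy, rfl⟩ := Finset.mem_image.mp hx
        by_cases hyb : y = b
        · rwa [hyb, hsb]
        by_cases hyc : y = c
        · rwa [hyc, hsc]
        rwa [hrefl0 y hy (hzero' y hy hyb hyc)]
  · push Not at hneg
    exfalso
    rcases hdesc with hlt | ⟨heq, hpos⟩
    · exact absurd (Finset.sum_nonneg hneg) (not_le.mpr hlt)
    · rw [Finset.sum_eq_zero_iff_of_nonneg hneg] at heq
      rw [hσ, Finset.sum_eq_zero fun b hb => by rw [heq b hb, zero_smul], sub_zero] at hpos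
      exact neg_notMem_pos (simple_mem_pos hα) hpos
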